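/- Let A be a graded algebra and P(σ), Δ(π) modules such that Hom_A(A, Δ(π)) ≅ Δ(π), P(σ) is a direct summand of A, B(π) = End_A(Δ(π))^op acts on Δ(π), and Δ(π) is finitely generated free as a right B(π)-module with B(π) a polynomial algebra. Then Hom_A(P(σ), Δ(π)) is a finitely generated free right B(π)-module. -/

import Mathlib

section QuillenSuslin
open Polynomial


lemma qs_rank_one {Λ P : Type*} [CommRing Λ] [IsDomain Λ] [UniqueFactorizationMonoid Λ]
    [AddCommGroup P] [Module Λ P] [Module.Finite Λ P] [Module.Projective Λ P]
    (c : P →ₗ[Λ] Λ) (hc : Function.Injective c) : Module.Free Λ P := by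
  classical
  by_cases h0 : ∀ y, c y = 0
  · have : Subsingleton P := ⟨fun x y => hc (by rw [h0, h0])⟩
    infer_instance
  push Not at h0
  obtain ⟨y, hy⟩ := h0
  obtain ⟨n, f, g, -, -, hfg⟩ := Module.Finite.exists_comp_eq_id_of_projective Λ P
  let _ : StrongNormalizationMonoid Λ := UniqueFactorizationMonoid.strongNormalizationMonoid
  let _ : NormalizedGCDMonoid Λ := UniqueFactorizationMonoid.toNormalizedGCDMonoid Λ
  let e : Fin n → P := fun i => f (Pi.single i 1)
  have hx : ∀ x, x = ∑ i, g x i • e i := by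
    intro x
    have h1 : f (g x) = x := LinearMap.congr_fun hfg x
    conv_lhs => rw [← h1, pi_eq_sum_univ' (g x)]
    simp [e, ← map_smul, Pi.single_apply, Pi.smul_def, eq_comm]
  have hcx : ∀ x, c x = ∑ i, g x i * c (e i) := by
    intro x
    conv_lhs => rw [hx x]
    simp
  have hcomm : ∀ x y i, c y * g x i = c x * g y i := by
    intro x y i
    have : c y • x = c x • y := hc (by simp [mul_comm])
    have := congrArg (fun z => g z i) this
    simpa using this
  let d := Finset.univ.gcd fun i => c (e i)
  have hd : ∀ i, c y ∣ g y i * d := by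
    intro i
    have h1 : c y ∣ Finset.univ.gcd fun j => g y i * c (e j) := by
      refine Finset.dvd_gcd fun j _ => ⟨g (e j) i, ?_⟩
      rw [hcomm (e j) y i, mul_comm]
    exact h1.trans (Finset.gcd_mul_left' _ _ _).dvd
  choose s hs using hd
  let z := ∑ i, s i • e i
  have hz : c z = d := by
    apply mul_left_cancel₀ hy
    conv_rhs => rw [hcx y]
    simp only [z, map_sum, map_smul, smul_eq_mul, Finset.mul_sum, Finset.sum_mul]
    refine Finset.sum_congr rfl fun i _ => ?_
    rw [← mul_assoc, ← hs]; ring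
  have hz0 : z ≠ 0 := by
    rintro h
    rw [h, map_zero] at hz
    have : ∀ i, c (e i) = 0 := fun i => by
      have := (Finset.gcd_eq_zero_iff.1 hz.symm) i (Finset.mem_univ _)
      simpa using this
    apply hy
    rw [hcx]; simp [this]
  have hinj : Function.Injective (LinearMap.toSpanSingleton Λ P z) := by
    intro a b hab
    have := congrArg c hab
    simp only [LinearMap.toSpanSingleton_apply, map_smul, smul_eq_mul] at this
    exact mul_right_cancel₀ (fun h => hz0 (hc (by simpa using h))) this
  have hsurj : Function.Surjective (LinearMap.toSpanSingleton Λ P z) := by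
    intro x
    have : d ∣ c x := by
      rw [hcx]
      exact Finset.dvd_sum fun i _ => Dvd.dvd.mul_left (Finset.gcd_dvd (Finset.mem_univ i)) _
    obtain ⟨w, hw⟩ := this
    exact ⟨w, hc (by simp [hz, hw, mul_comm])⟩
  exact Module.Free.of_equiv (LinearEquiv.ofBijective _ ⟨hinj, hsurj⟩)

lemma qs_unimod {R : Type*} [CommRing R] [IsLocalRing R] (J : Ideal R[X]) (g : R[X])
    (hg : g.Monic) (hgJ : g ∈ J) (h : J ⊔ (IsLocalRing.maximalIdeal R).map C = ⊤) : J = ⊤ := by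
  by_contra hJ
  obtain ⟨M, hM, hJM⟩ := Ideal.exists_le_maximal J hJ
  have hgInt := hg.quotient_isIntegral (hJM hgJ)
  have : (⊥ : Ideal (R[X] ⧸ M)).IsMaximal := Ideal.bot_quotient_isMaximal_iff M |>.2 hM
  have h2 := Ideal.isMaximal_comap_of_isIntegral_of_isMaximal' _ hgInt (⊥ : Ideal (R[X] ⧸ M))
  have h3 := IsLocalRing.eq_maximalIdeal h2
  apply hM.ne_top
  rw [eq_top_iff, ← h]
  refine sup_le hJM (Ideal.map_le_iff_le_comap.2 ?_)
  rw [← h3]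
  intro x hx
  have hx' : Ideal.Quotient.mk M (C x) = 0 := hx
  exact (Ideal.Quotient.eq_zero_iff_mem (I := M)).1 hx'

lemma qs_mod {Λ P : Type*} [CommRing Λ] (I : Ideal Λ) [IsDomain (Λ ⧸ I)]
    [IsPrincipalIdealRing (Λ ⧸ I)] [AddCommGroup P] [Module Λ P] [Module.Finite Λ P]
    [Module.Projective Λ P] (p1 p2 : P)
    (h : ∀ a b : Λ, a • p1 + b • p2 ∈ I • (⊤ : Submodule Λ P) → a ∈ I ∧ b ∈ I) :
    ∃ (e : P) (φ1 φ2 : P →ₗ[Λ] Λ), φ1 e - 1 ∈ I ∧ φ2 e ∈ I ∧ φ2 p2 ∉ I := by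
  classical
  let Q := TensorProduct Λ (Λ ⧸ I) P
  let π : P →ₗ[Λ] Q := TensorProduct.mk Λ (Λ ⧸ I) P 1
  have hπ : ∀ x, π x = 0 → x ∈ I • (⊤ : Submodule Λ P) := by
    intro x hx
    have := congrArg (TensorProduct.quotTensorEquivQuotSMul P I) hx
    have h2 : TensorProduct.quotTensorEquivQuotSMul P I (π x)
      = Submodule.Quotient.mk x := by
        have := TensorProduct.quotTensorEquivQuotSMul_mk_tmul (M := P) I 1 x
        rw [one_smul] at this
        exact this
    rw [h2, map_zero] at this
    exact (Submodule.Quotient.mk_eq_zero _).1 this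
  have hπs : ∀ (a : Λ) x, π (a • x) = (Ideal.Quotient.mk I a) • π x := by
    intro a x
    rw [map_smul]; rfl
  have hsurj : Function.Surjective π :=
    TensorProduct.mk_surjective _ _ _ Ideal.Quotient.mk_surjective
  have : Module.Free (Λ ⧸ I) Q := Module.free_of_finite_type_torsion_free'
  let b := Module.Free.chooseBasis (Λ ⧸ I) Q
  have hp2 : π p2 ≠ 0 := by
    intro h0
    have := (h 0 1 (by simpa using hπ _ h0)).2
    have h1 : (1 : Λ ⧸ I) = 0 := Ideal.Quotient.eq_zero_iff_mem.2 this
    exact one_ne_zero h1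
  obtain ⟨i, hi⟩ : ∃ i, b.repr (π p2) i ≠ 0 := by
    by_contra! hcon
    exact hp2 (b.repr.injective (by ext i; simp [hcon]))
  obtain ⟨j, hj⟩ : ∃ j, j ≠ i := by
    by_contra! hcon
    obtain ⟨a1, ha1⟩ := Ideal.Quotient.mk_surjective (b.repr (π p1) i)
    obtain ⟨a2, ha2⟩ := Ideal.Quotient.mk_surjective (b.repr (π p2) i)
    have := (h a2 (-a1) (hπ _ (by
      apply b.repr.injective
      ext j
      rw [hcon j, map_add, hπs, hπs, map_neg, ha1, ha2]
      simp
      ring))).1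
    exact hi (by rw [← ha2]; exact Ideal.Quotient.eq_zero_iff_mem.2 this)
  have hlift : ∀ i, ∃ φ : P →ₗ[Λ] Λ, ∀ x, Ideal.Quotient.mk I (φ x) = b.repr (π x) i := by
    intro i
    obtain ⟨φ, hφ⟩ := Module.projective_lifting_property (Submodule.mkQ I)
      (((b.coord i).restrictScalars Λ) ∘ₗ π) (Submodule.mkQ_surjective _)
    exact ⟨φ, fun x => LinearMap.congr_fun hφ x⟩
  obtain ⟨φ1, h1⟩ := hlift j
  obtain ⟨φ2, h2⟩ := hlift i
  obtain ⟨e, he⟩ := hsurj (b j)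
  refine ⟨e, φ1, φ2, ?_, ?_, ?_⟩
  · rw [← Ideal.Quotient.eq_zero_iff_mem, map_sub, h1, he]; simp
  · rw [← Ideal.Quotient.eq_zero_iff_mem, h2, he]; simp [hj]
  · rw [← Ideal.Quotient.eq_zero_iff_mem, h2]; exact hi

lemma qs_coord {Λ P ι : Type*} [CommRing Λ] [AddCommGroup P] [Module Λ P] [Fintype ι]
    (p : ι → P) (hp : LinearIndependent Λ p) (f : Λ)
    (hf : ∀ x, f • x ∈ Submodule.span Λ (Set.range p)) :
    ∃ c : P →ₗ[Λ] (ι → Λ), ∀ x, f • x = ∑ i, c x i • p i := by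
  let m : P →ₗ[Λ] Submodule.span Λ (Set.range p) :=
    (LinearMap.lsmul Λ P f).codRestrict _ hf
  refine ⟨(Finsupp.linearEquivFunOnFinite Λ Λ ι).toLinearMap ∘ₗ hp.repr ∘ₗ m, ?_⟩
  intro x
  have := hp.linearCombination_repr (m x)
  rw [Finsupp.linearCombination_apply, Finsupp.sum_fintype _ _ (by simp)] at this
  exact this.symm

lemma qs_monic_lift {R : Type*} [CommRing R] [IsLocalRing R] (a : R[X])
    (ha : a ∉ (IsLocalRing.maximalIdeal R).map C) :
    ∃ h w : R[X], h.Monic ∧ h - a * w ∈ (IsLocalRing.maximalIdeal R).map C := by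
  have hker : RingHom.ker (mapRingHom (IsLocalRing.residue R))
      = (IsLocalRing.maximalIdeal R).map C := by
    rw [Polynomial.ker_mapRingHom, IsLocalRing.ker_residue]
  rw [← hker, RingHom.mem_ker, coe_mapRingHom] at ha
  obtain ⟨w, hw⟩ := IsLocalRing.residue_surjective (a.map (IsLocalRing.residue R)).leadingCoeff⁻¹
  have hmon := monic_mul_leadingCoeff_inv ha
  have hl : (a.map (IsLocalRing.residue R)) * C (a.map (IsLocalRing.residue R)).leadingCoeff⁻¹
      ∈ lifts (IsLocalRing.residue R) := by
    rw [mem_lifts]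
    exact ⟨a * C w, by simp [hw]⟩
  obtain ⟨h, h1, -, h3⟩ := lifts_and_natDegree_eq_and_monic hl hmon
  refine ⟨h, C w, h3, ?_⟩
  rw [← hker, RingHom.mem_ker, map_sub, coe_mapRingHom, h1]
  simp [hw]

theorem qs_horrocks (R : Type*) [CommRing R] [IsDomain R] [IsLocalRing R]
    [UniqueFactorizationMonoid R] (r : ℕ) : ∀ (P : Type) [AddCommGroup P] [Module R[X] P]
    [Module.Finite R[X] P] [Module.Projective R[X] P] (p : Fin r → P)
    (_ : LinearIndependent R[X] p) (f : R[X]) (_ : f.Monic)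
    (_ : ∀ x : P, f • x ∈ Submodule.span R[X] (Set.range p)), Module.Free R[X] P := by
  induction r with
  | zero =>
    intro P _ _ _ _ p hp f hf hspan
    have : Subsingleton P := by
      refine subsingleton_of_forall_eq 0 fun x => ?_
      have := hspan x
      simp only [Set.range_eq_empty, Submodule.span_empty, Submodule.mem_bot] at this
      exact (smul_eq_zero.1 this).resolve_left hf.ne_zero
    infer_instance
  | succ r ih =>
    intro P _ _ _ _ p hp f hf hspan
    obtain ⟨c, hc⟩ := qs_coord p hp f hspan
    have hcp : ∀ j i, c (p j) i = if j = i then f else 0 := by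
      intro j i
      have h1 := hc (p j)
      have h2 : ∑ i, (c (p j) i - if j = i then f else 0) • p i = 0 := by
        simp only [sub_smul, Finset.sum_sub_distrib, ← h1, ite_smul, zero_smul]
        simp
      exact sub_eq_zero.1 (Fintype.linearIndependent_iff.1 hp _ h2 i)
    rcases r with _ | r
    · refine qs_rank_one ((LinearMap.proj 0).comp c) ?_
      rw [← LinearMap.ker_eq_bot, LinearMap.ker_eq_bot']
      intro x hx
      have := hc x
      simp only [LinearMap.comp_apply, LinearMap.proj_apply] at hx
      rw [Fin.sum_univ_one, hx, zero_smul] at this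
      exact (smul_eq_zero.1 this).resolve_left hf.ne_zero
    set I : Ideal R[X] := (IsLocalRing.maximalIdeal R).map C with hI
    have hdom : IsDomain (R[X] ⧸ I) := Ideal.isDomain_map_C_quotient inferInstance
    have hpid : IsPrincipalIdealRing (R[X] ⧸ I) := by
      let _ : Field (R ⧸ IsLocalRing.maximalIdeal R) := Ideal.Quotient.field _
      exact IsPrincipalIdealRing.of_surjective
        (Ideal.polynomialQuotientEquivQuotientPolynomial (IsLocalRing.maximalIdeal R)).toRingHom
        (Ideal.polynomialQuotientEquivQuotientPolynomial (IsLocalRing.maximalIdeal R)).surjective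
    have hprime : I.IsPrime := (Ideal.Quotient.isDomain_iff_prime I).1 hdom
    have hfI : f ∉ I := by
      intro h
      have := (Ideal.mem_map_C_iff.1 h) f.natDegree
      rw [hf.coeff_natDegree] at this
      exact (Ideal.ne_top_iff_one _).1 (IsLocalRing.maximalIdeal.isMaximal R).ne_top this
    have hcI : ∀ x ∈ I • (⊤ : Submodule R[X] P), ∀ i, c x i ∈ I := by
      intro x hx i
      refine Submodule.smul_induction_on hx ?_ ?_
      · intro a ha n _
        simpa using I.mul_mem_right _ ha
      · intro x y hx hy
        simpa using I.add_mem hx hy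
    obtain ⟨e, φ1, φ2, h1, h2, h3⟩ := qs_mod I (p 1) (p 0) (by
      intro a b hab
      have ha := hcI _ hab 1
      have hb := hcI _ hab 0
      have e1 : c (a • p 1 + b • p 0) 1 = a * f := by simp [hcp]
      have e0 : c (a • p 1 + b • p 0) 0 = b * f := by simp [hcp]
      rw [e1] at ha
      rw [e0] at hb
      exact ⟨(hprime.mem_or_mem ha).resolve_right hfI, (hprime.mem_or_mem hb).resolve_right hfI⟩)
    obtain ⟨h0, w, hh0, hw⟩ := qs_monic_lift _ h3
    rw [← hI] at hw
    set N := (c e 0).natDegree + 1 with hN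
    set u := e + (h0 * X ^ N) • p 0 with hu
    set g := c u 0 with hg
    have hgm : g.Monic := by
      have : g = c e 0 + (h0 * X ^ N) * f := by
        rw [hg, hu]
        simp [hcp]
      rw [this]
      have hm : (h0 * X ^ N * f).Monic := (hh0.mul (monic_X_pow N)).mul hf
      refine hm.add_of_right ?_
      apply degree_lt_degree
      rw [(hh0.mul (monic_X_pow N)).natDegree_mul hf, hh0.natDegree_mul (monic_X_pow N),
        natDegree_X_pow]
      omega
    let J : Ideal R[X] := LinearMap.range (LinearMap.applyₗ (R := R[X]) (M₂ := R[X]) u)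
    have hJ : J = ⊤ := by
      refine qs_unimod J g hgm ⟨(LinearMap.proj 0).comp c, rfl⟩ ?_
      rw [Ideal.eq_top_iff_one]
      let ψ := (1 - φ2 (p 0) * (w * X ^ N) * φ1 (p 0)) • φ1 +
        (w * X ^ N * φ1 (p 0) ^ 2) • φ2
      have hψ : ψ u - 1 ∈ I := by
        rw [← Ideal.Quotient.eq_zero_iff_mem] at h1 h2 hw ⊢
        rw [map_sub, sub_eq_zero] at h1 hw
        simp only [map_mul] at hw
        simp only [ψ, hu, map_sub, map_add, map_mul, LinearMap.add_apply, LinearMap.smul_apply,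
          smul_eq_mul, map_smul, h1, h2, hw, map_one, map_pow]
        ring
      rw [← sub_sub_cancel (ψ u) 1]
      exact Ideal.sub_mem _ (Ideal.mem_sup_left ⟨ψ, rfl⟩) (Ideal.mem_sup_right hψ)
    obtain ⟨ψ, hψ⟩ : (1 : R[X]) ∈ J := by rw [hJ]; trivial
    replace hψ : ψ u = 1 := hψ
    let P' := LinearMap.ker ψ
    let π : P →ₗ[R[X]] P' := LinearMap.codRestrict P'
      (LinearMap.id - (LinearMap.toSpanSingleton R[X] P u).comp ψ) (by
        intro x; simp [P', hψ])
    have hπ : ∀ x, (π x : P) = x - ψ x • u := fun x => rfl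
    have hπi : π.comp P'.subtype = LinearMap.id := by
      ext x
      have : ψ x = 0 := x.2
      simp [hπ, this]
    have hπ2 : ∀ x : P', π x = x := fun x => LinearMap.congr_fun hπi x
    have hπu : π u = 0 := by
      ext; simp [hπ, hψ]
    have : Module.Projective R[X] P' := Module.Projective.of_split _ _ hπi
    have : Module.Finite R[X] P' := Module.Finite.of_surjective π fun x => ⟨x, hπ2 x⟩
    have hfu : f • u = g • p 0 + ∑ i : Fin (r + 1), c u i.succ • p i.succ := by
      rw [hc u, Fin.sum_univ_succ]
    have hfree : Module.Free R[X] P' := by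
      refine ih P' (fun i => π (p i.succ)) ?_ (g * f) (hgm.mul hf) ?_
      · rw [Fintype.linearIndependent_iff]
        intro a ha
        obtain ⟨s, h4⟩ : ∃ s : R[X], ∑ i, a i • p i.succ = s • u := by
          refine ⟨ψ (∑ i, a i • p i.succ), ?_⟩
          have h6 := hπ (∑ i, a i • p i.succ)
          have h7 : π (∑ i, a i • p i.succ) = 0 := by
            rw [map_sum]; simpa only [map_smul] using ha
          rw [h7] at h6
          exact sub_eq_zero.1 h6.symm
        have h5 : c (∑ i, a i • p i.succ) 0 = 0 := by
          rw [map_sum, Finset.sum_apply]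
          exact Finset.sum_eq_zero fun i _ => by simp [hcp, Fin.succ_ne_zero]
        rw [h4, map_smul, Pi.smul_apply, smul_eq_mul] at h5
        have hs : s = 0 := (mul_eq_zero.1 h5).resolve_right hgm.ne_zero
        rw [hs, zero_smul] at h4
        exact Fintype.linearIndependent_iff.1 (hp.comp _ (Fin.succ_injective _)) a h4
      · intro x
        have hp0 : g • π (p 0) ∈ Submodule.span R[X] (Set.range fun i => π (p (Fin.succ i))) := by
          have := congrArg π hfu
          rw [map_smul, hπu, smul_zero, map_add, map_smul] at this
          rw [← neg_mem_iff, neg_eq_of_add_eq_zero_right this.symm, map_sum]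
          refine Submodule.sum_mem _ fun i _ => ?_
          rw [map_smul]
          exact Submodule.smul_mem _ _ (Submodule.subset_span ⟨i, rfl⟩)
        have := congrArg π (hc x)
        rw [map_smul, hπ2, Fin.sum_univ_succ, map_add, map_sum, map_smul] at this
        rw [mul_smul, this, smul_add, smul_comm]
        refine Submodule.add_mem _ (Submodule.smul_mem _ _ hp0)
          (Submodule.smul_mem _ _ (Submodule.sum_mem _ fun i _ => ?_))
        rw [map_smul]
        exact Submodule.smul_mem _ _ (Submodule.subset_span ⟨i, rfl⟩)
    let E : P ≃ₗ[R[X]] R[X] × P' := LinearEquiv.ofLinearMap (ψ.prod π)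
      ((LinearMap.toSpanSingleton R[X] P u).coprod P'.subtype)
      (by
        ext
        · simp [hψ]
        · simp [hπu]
        · simp
        · simp [hπ2])
      (by ext x; simp [hπ])
    exact Module.Free.of_equiv E.symm


/-- Conjugacy of square matrices, with explicit inverse. -/
def QSConj {n R : Type*} [Fintype n] [DecidableEq n] [CommRing R] (E F : Matrix n n R) : Prop :=
  ∃ U V : Matrix n n R, U * V = 1 ∧ V * U = 1 ∧ E * U = U * F

/-- The diagonal zero-one matrix attached to a Boolean function. -/
def qsD {n : Type*} (R : Type*) [DecidableEq n] [CommRing R] (d : n → Bool) : Matrix n n R :=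
  Matrix.diagonal fun i => if d i then 1 else 0

lemma QSConj.symm {n R : Type*} [Fintype n] [DecidableEq n] [CommRing R] {E F : Matrix n n R}
    (h : QSConj E F) : QSConj F E := by
  obtain ⟨U, V, h1, h2, h3⟩ := h
  refine ⟨V, U, h2, h1, ?_⟩
  calc F * V = (V * U) * F * V := by rw [h2, one_mul]
    _ = V * (U * F) * V := by simp only [mul_assoc]
    _ = V * (E * U) * V := by rw [h3]
    _ = V * E * (U * V) := by simp only [mul_assoc]
    _ = V * E := by rw [h1, mul_one]

lemma QSConj.trans {n R : Type*} [Fintype n] [DecidableEq n] [CommRing R] {E F G : Matrix n n R}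
    (h : QSConj E F) (h' : QSConj F G) : QSConj E G := by
  obtain ⟨U, V, h1, h2, h3⟩ := h
  obtain ⟨U', V', h1', h2', h3'⟩ := h'
  refine ⟨U * U', V' * V, ?_, ?_, ?_⟩
  · rw [mul_assoc, ← mul_assoc U', h1', one_mul, h1]
  · rw [mul_assoc, ← mul_assoc V, h2, one_mul, h2']
  · rw [← mul_assoc, h3, mul_assoc, h3', mul_assoc]

lemma QSConj.map {n R S : Type*} [Fintype n] [DecidableEq n] [CommRing R] [CommRing S]
    {E F : Matrix n n R} (h : QSConj E F) (f : R →+* S) : QSConj (E.map f) (F.map f) := by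
  obtain ⟨U, V, h1, h2, h3⟩ := h
  refine ⟨U.map f, V.map f, ?_, ?_, ?_⟩
  · rw [← Matrix.map_mul, h1]; simp
  · rw [← Matrix.map_mul, h2]; simp
  · rw [← Matrix.map_mul, h3]; simp [Matrix.map_mul]

lemma qsD_map {n R S : Type*} [DecidableEq n] [CommRing R] [CommRing S] (d : n → Bool)
    (f : R →+* S) : (qsD R d).map f = qsD S d := by
  rw [qsD, Matrix.diagonal_map (map_zero f), qsD]
  congr 1
  ext i
  by_cases h : d i = true <;> simp [h]

lemma qs_diag_of_free {n R : Type*} [Fintype n] [DecidableEq n] [CommRing R] [Nontrivial R]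
    (E : Matrix n n R) (hE : E * E = E) (h1 : Module.Free R (LinearMap.range E.mulVecLin))
    (h2 : Module.Free R (LinearMap.range (1 - E).mulVecLin)) : ∃ d, QSConj E (qsD R d) := by
  have hEE : ∀ x, E.mulVec (E.mulVec x) = E.mulVec x := by
    intro x; rw [Matrix.mulVec_mulVec, hE]
  have e1 : ∀ x ∈ LinearMap.range E.mulVecLin, E.mulVec x = x := by
    rintro _ ⟨y, rfl⟩
    exact hEE y
  have e2 : ∀ x ∈ LinearMap.range (1 - E).mulVecLin, E.mulVec x = 0 := by
    rintro _ ⟨y, rfl⟩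
    simp [Matrix.sub_mulVec, Matrix.mulVec_sub, hE]
  have hc : IsCompl (LinearMap.range E.mulVecLin) (LinearMap.range (1 - E).mulVecLin) := by
    constructor
    · rw [Submodule.disjoint_def]
      intro x hx hx'
      rw [← e1 x hx, e2 x hx']
    · rw [codisjoint_iff, eq_top_iff]
      intro x _
      refine Submodule.mem_sup.2 ⟨E.mulVecLin x, ⟨x, rfl⟩, (1 - E).mulVecLin x, ⟨x, rfl⟩, ?_⟩
      simp [Matrix.sub_mulVec]
  let b0 := ((Module.Free.chooseBasis R (LinearMap.range E.mulVecLin)).prod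
    (Module.Free.chooseBasis R (LinearMap.range (1 - E).mulVecLin))).map
    (Submodule.prodEquivOfIsCompl _ _ hc)
  let b := b0.reindex (b0.indexEquiv (Pi.basisFun R n))
  have hb : ∀ j, E.mulVec (b j) = b j ∨ E.mulVec (b j) = 0 := by
    intro j
    simp only [b, Module.Basis.reindex_apply]
    rcases (b0.indexEquiv (Pi.basisFun R n)).symm j with i | i
    · left
      apply e1
      simp [b0]
    · right
      apply e2
      have : b0 (Sum.inr i) =
          (Module.Free.chooseBasis R (LinearMap.range (1 - E).mulVecLin) i : n → R) := by
        simp [b0]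
      rw [this]
      exact Subtype.property _
  classical
  refine ⟨fun j => decide (E.mulVec (b j) = b j), (Pi.basisFun R n).toMatrix b,
    b.toMatrix (Pi.basisFun R n), ?_, ?_, ?_⟩
  · exact (Pi.basisFun R n).toMatrix_mul_toMatrix_flip b
  · exact b.toMatrix_mul_toMatrix_flip (Pi.basisFun R n)
  · ext i j
    rw [qsD, Matrix.mul_diagonal]
    have : (E * (Pi.basisFun R n).toMatrix b) i j = E.mulVec (b j) i := by
      simp [Matrix.mul_apply, Matrix.mulVec, dotProduct, Module.Basis.toMatrix_apply]
    rw [this]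
    rcases hb j with h | h
    · simp [h, Module.Basis.toMatrix_apply]
    · have : ¬ (E.mulVec (b j) = b j) := by
        rw [h]; exact (b.ne_zero j).symm
      simp only [this]
      simp [h]

lemma qs_lattice {n R : Type*} [Fintype n] [DecidableEq n] [CommRing R] [IsDomain R]
    (E : Matrix n n R) (d : n → Bool) (G G' : Matrix n n R) (f : R) (hf : f ≠ 0)
    (h1 : G * G' = f • (1 : Matrix n n R)) (h2 : G' * G = f • (1 : Matrix n n R))
    (h3 : E * G = G * qsD R d) (hE : E * E = E) :
    ∃ (r : ℕ) (p : Fin r → LinearMap.range E.mulVecLin), LinearIndependent R p ∧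
      ∀ x, f • x ∈ Submodule.span R (Set.range p) := by
  have hcol : ∀ i, d i = true → E.mulVec (G.col i) = G.col i := by
    intro i hi
    ext j
    have := congrFun (congrFun h3 j) i
    rw [qsD, Matrix.mul_diagonal] at this
    simpa [hi, Matrix.mul_apply, Matrix.mulVec, dotProduct] using this
  let p0 : {i // d i = true} → LinearMap.range E.mulVecLin := fun i =>
    ⟨G.col i, ⟨G.col i, hcol i i.2⟩⟩
  have hind : LinearIndependent R G.col := by
    have hinj : Function.Injective G.mulVec := by
      intro x y hxy
      have := congrArg G'.mulVec hxy
      simp only [Matrix.mulVec_mulVec, h2, Matrix.smul_mulVec, Matrix.one_mulVec] at this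
      exact smul_right_injective _ hf this
    exact Matrix.mulVec_injective_iff.1 hinj
  have hp0 : LinearIndependent R p0 := by
    apply LinearIndependent.of_comp (LinearMap.range E.mulVecLin).subtype
    exact hind.comp _ Subtype.val_injective
  have hspan : ∀ x, f • x ∈ Submodule.span R (Set.range p0) := by
    rintro ⟨x, y, rfl⟩
    have key : f • E.mulVec y = ∑ i, (G'.mulVec y i) • (if d i then G.col i else 0) := by
      calc f • E.mulVec y = (E * (f • 1)).mulVec y := by simp [Matrix.smul_mulVec]
        _ = (G * qsD R d).mulVec (G'.mulVec y) := by
            rw [← h1, ← mul_assoc, h3, Matrix.mulVec_mulVec]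
        _ = _ := by
            ext j
            simp [qsD, Matrix.mulVec, dotProduct, Matrix.mul_diagonal, Finset.sum_apply]
            refine Finset.sum_congr rfl fun i _ => ?_
            split_ifs <;> simp [mul_comm]
    have key2 : f • (⟨E.mulVecLin y, y, rfl⟩ : LinearMap.range E.mulVecLin)
        = ∑ i, (G'.mulVec y i) • (if h : d i = true then p0 ⟨i, h⟩ else 0) := by
      apply Subtype.ext
      rw [Submodule.coe_smul, Submodule.coe_sum]
      refine key.trans ?_
      refine Finset.sum_congr rfl fun i _ => ?_
      split_ifs <;> simp [p0]
    rw [key2]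
    refine Submodule.sum_mem _ fun i _ => Submodule.smul_mem _ _ ?_
    split_ifs
    · exact Submodule.subset_span ⟨_, rfl⟩
    · exact zero_mem _
  let σ := Fintype.equivFin {i // d i = true}
  refine ⟨_, p0 ∘ σ.symm, hp0.comp _ σ.symm.injective, ?_⟩
  rwa [Set.range_comp, σ.symm.surjective.range_eq, Set.image_univ]

lemma qs_free_of_diag {n R : Type*} [Fintype n] [DecidableEq n] [CommRing R] [IsDomain R]
    (E : Matrix n n R) (hE : E * E = E) (d : n → Bool) (h : QSConj E (qsD R d)) :
    Module.Free R (LinearMap.range E.mulVecLin) := by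
  obtain ⟨U, V, h1, h2, h3⟩ := h
  obtain ⟨r, p, hp, hs⟩ := qs_lattice E d U V 1 one_ne_zero (by simpa) (by simpa) h3 hE
  exact Module.Free.of_basis (Module.Basis.mk hp fun x _ => by simpa using hs x)

lemma qs_one_sub {n R : Type*} [Fintype n] [DecidableEq n] [CommRing R]
    (d : n → Bool) : 1 - qsD R d = qsD R (fun i => !(d i)) := by
  rw [qsD, qsD, ← Matrix.diagonal_one, Matrix.diagonal_sub]
  congr 1
  ext i
  cases d i <;> simp

/-- Finitely generated projective modules are free. -/
def QSFree (R : Type) [CommRing R] : Prop :=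
  ∀ (P : Type) [AddCommGroup P] [Module R P] [Module.Finite R P] [Module.Projective R P],
    Module.Free R P

/-- Idempotent matrices are conjugate to zero-one diagonal ones. -/
def QSMat (R : Type) [CommRing R] : Prop :=
  ∀ (n : ℕ) (E : Matrix (Fin n) (Fin n) R), E * E = E → ∃ d, QSConj E (qsD R d)

lemma qs_range_proj {n R : Type*} [Fintype n] [DecidableEq n] [CommRing R]
    (E : Matrix n n R) (hE : E * E = E) : Module.Projective R (LinearMap.range E.mulVecLin) := by
  refine Module.Projective.of_split (LinearMap.range E.mulVecLin).subtype
    E.mulVecLin.rangeRestrict ?_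
  ext1 ⟨x, y, rfl⟩
  apply Subtype.ext
  simp [hE]

lemma QSFree.mat {R : Type} [CommRing R] [Nontrivial R] (h : QSFree R) : QSMat R := by
  intro n E hE
  have hE' : (1 - E) * (1 - E) = 1 - E := by
    rw [mul_sub, sub_mul, sub_mul, hE]; simp
  have := qs_range_proj E hE
  have := qs_range_proj (1 - E) hE'
  exact qs_diag_of_free E hE (h _) (h _)

lemma QSMat.free {R : Type} [CommRing R] [IsDomain R] (h : QSMat R) : QSFree R := by
  intro P _ _ _ _
  obtain ⟨n, f, g, hf, hg, hfg⟩ := Module.Finite.exists_comp_eq_id_of_projective R P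
  let E := LinearMap.toMatrix' (g ∘ₗ f)
  have hE : E * E = E := by
    rw [← LinearMap.toMatrix'_comp]
    congr 1
    rw [LinearMap.comp_assoc, ← LinearMap.comp_assoc f, hfg, LinearMap.id_comp]
  have hEl : E.mulVecLin = g ∘ₗ f := by
    rw [← Matrix.toLin'_apply', Matrix.toLin'_toMatrix']
  obtain ⟨d, hd⟩ := h n E hE
  have hfree := qs_free_of_diag E hE d hd
  rw [hEl, LinearMap.range_comp_of_range_eq_top _ (LinearMap.range_eq_top.2 hf)] at hfree
  exact Module.Free.of_equiv (LinearEquiv.ofInjective g hg).symm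

lemma qs_local {R : Type} [CommRing R] [IsDomain R] [IsLocalRing R]
    [UniqueFactorizationMonoid R] {n : ℕ} (E : Matrix (Fin n) (Fin n) R[X]) (hE : E * E = E)
    (d : Fin n → Bool) (G G' : Matrix (Fin n) (Fin n) R[X]) (f : R[X]) (hf : f.Monic)
    (h1 : G * G' = f • (1 : Matrix (Fin n) (Fin n) R[X]))
    (h2 : G' * G = f • (1 : Matrix (Fin n) (Fin n) R[X]))
    (h3 : E * G = G * qsD R[X] d) : ∃ d, QSConj E (qsD R[X] d) := by
  have hE' : (1 - E) * (1 - E) = 1 - E := by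
    rw [mul_sub, sub_mul, sub_mul, hE]; simp
  have h3' : (1 - E) * G = G * qsD R[X] (fun i => !(d i)) := by
    rw [← qs_one_sub, sub_mul, h3, mul_sub, one_mul, mul_one]
  have := qs_range_proj E hE
  have := qs_range_proj (1 - E) hE'
  obtain ⟨r, p, hp, hs⟩ := qs_lattice E d G G' f hf.ne_zero h1 h2 h3 hE
  obtain ⟨r', p', hp', hs'⟩ := qs_lattice (1 - E) _ G G' f hf.ne_zero h1 h2 h3' hE'
  exact qs_diag_of_free E hE (qs_horrocks R r _ p hp f hf hs)
    (qs_horrocks R r' _ p' hp' f hf hs')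


lemma qs_map_comp {n A B C : Type*} [CommRing A] [CommRing B] [CommRing C]
    (E : Matrix n n A) (f : A →+* B) (g : B →+* C) : (E.map f).map g = E.map (g.comp f) := by
  ext; simp

lemma qs_clear {R S ι : Type*} [CommRing R] [CommRing S] [Algebra R S] (M : Submonoid R)
    [IsLocalization M S] [Fintype ι] (q : ι → S[X][X])
    (h0 : ∀ i, (q i).coeff 0 ∈ Set.range (mapRingHom (algebraMap R S))) :
    ∃ c ∈ M, ∀ i, ∃ q0 : R[X][X], mapRingHom (mapRingHom (algebraMap R S)) q0 =
      compRingHom (C (C (algebraMap R S c)) * X) (q i) := by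
  letI := Polynomial.algebra R S
  have := Polynomial.isLocalization M S
  obtain ⟨⟨b, c, hc, rfl⟩, hb⟩ := IsLocalization.exist_integer_multiples (Submonoid.map C M)
    (Finset.univ.sigma fun i => (q i).support) (fun z : (Σ _ : ι, ℕ) => (q z.1).coeff z.2)
  refine ⟨c, hc, fun i => ?_⟩
  have hl : compRingHom (C (C (algebraMap R S c)) * X) (q i) ∈
      lifts (mapRingHom (algebraMap R S)) := by
    rw [lifts_iff_coeff_lifts]
    intro k
    rw [coe_compRingHom_apply, comp_C_mul_X_coeff]
    rcases k with _ | k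
    · simpa using h0 i
    by_cases hk : k + 1 ∈ (q i).support
    · obtain ⟨y, hy⟩ := hb ⟨i, k + 1⟩ (by simpa using hk)
      refine ⟨y * C c ^ k, ?_⟩
      have hy' : mapRingHom (algebraMap R S) y = C (algebraMap R S c) * (q i).coeff (k + 1) := by
        refine Eq.trans hy ?_
        rw [Algebra.smul_def]
        congr 1
        exact Polynomial.map_C _
      rw [map_mul, hy', map_pow, coe_mapRingHom, Polynomial.map_C]
      ring
    · rw [notMem_support_iff] at hk
      exact ⟨0, by simp [hk]⟩
  obtain ⟨q0, hq0⟩ := (mem_lifts _).1 hl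
  exact ⟨q0, hq0⟩

lemma qs_patch_local {R : Type} [CommRing R] [IsDomain R] {n : ℕ}
    (E : Matrix (Fin n) (Fin n) R[X]) (p : Ideal R) [p.IsPrime] (d : Fin n → Bool)
    (S : Type) [CommRing S] [Algebra R S] [IsLocalization p.primeCompl S]
    (h : QSConj (E.map (mapRingHom (algebraMap R S))) (qsD _ d)) :
    ∃ c ∈ p.primeCompl, ∀ (B : Type) [CommRing B] (φ : R →+* B) (a b : B),
      QSConj (E.map (eval₂RingHom φ (a + φ c * b))) (E.map (eval₂RingHom φ a)) := by
  obtain ⟨U, V, h1, h2, h3⟩ := h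
  let i1 := mapRingHom (algebraMap R S)
  let j := mapRingHom i1
  have hinj : Function.Injective j := by
    refine map_injective _ (map_injective _ ?_)
    exact IsLocalization.injective S p.primeCompl_le_nonZeroDivisors
  let θ : S[X] →+* S[X][X] := eval₂RingHom ((C : S[X] →+* S[X][X]).comp (C : S →+* S[X])) (C X + X : S[X][X])
  have hθ0 : (evalRingHom (0 : S[X])).comp θ = RingHom.id _ := by
    ext <;> simp [θ]
  have hC0 : (evalRingHom (0 : S[X])).comp C = RingHom.id _ := by
    ext <;> simp
  have e1 : U.map θ * V.map θ = 1 := by rw [← Matrix.map_mul, h1]; simp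
  have e2 : V.map θ * U.map θ = 1 := by rw [← Matrix.map_mul, h2]; simp
  have e3 : U.map C * V.map C = 1 := by rw [← Matrix.map_mul, h1]; simp
  have e4 : V.map C * U.map C = 1 := by rw [← Matrix.map_mul, h2]; simp
  let H := U.map θ * V.map C
  let H' := U.map C * V.map θ
  have hH1 : H * H' = 1 := by
    simp only [H, H']
    rw [mul_assoc, ← mul_assoc (V.map C), e4, one_mul, e1]
  have hH2 : H' * H = 1 := by
    simp only [H, H']
    rw [mul_assoc, ← mul_assoc (V.map θ), e2, one_mul, e3]
  have hH3 : (E.map i1).map θ * H = H * (E.map i1).map C := by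
    have a1 : (E.map i1).map θ * U.map θ = U.map θ * qsD _ d := by
      rw [← Matrix.map_mul, h3, Matrix.map_mul, qsD_map]
    have a2 : (E.map i1).map C * U.map C = U.map C * qsD _ d := by
      rw [← Matrix.map_mul, h3, Matrix.map_mul, qsD_map]
    have a3 : V.map C * (E.map i1).map C = qsD _ d * V.map C := by
      calc V.map C * (E.map i1).map C
          = V.map C * ((E.map i1).map C * U.map C) * V.map C := by
            rw [mul_assoc, mul_assoc _ (U.map C), e3, mul_one]
        _ = _ := by rw [a2, ← mul_assoc, e4, one_mul]
    simp only [H]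
    rw [← mul_assoc, a1, mul_assoc, mul_assoc, a3]
  have hH0 : H.map (evalRingHom 0) = 1 := by
    simp only [H]
    rw [Matrix.map_mul, qs_map_comp, qs_map_comp, hθ0, hC0]
    simpa using h1
  have hH0' : H'.map (evalRingHom 0) = 1 := by
    simp only [H']
    rw [Matrix.map_mul, qs_map_comp, qs_map_comp, hθ0, hC0]
    simpa using h1
  have hone : ∀ (N : Matrix (Fin n) (Fin n) S[X][X]), N.map (evalRingHom 0) = 1 →
      ∀ x y, (N x y).coeff 0 ∈ Set.range i1 := by
    intro N hN x y
    have := congrFun (congrFun hN x) y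
    rw [Matrix.map_apply, coe_evalRingHom, ← coeff_zero_eq_eval_zero] at this
    rw [this, Matrix.one_apply]
    split_ifs
    · exact ⟨1, map_one _⟩
    · exact ⟨0, map_zero _⟩
  obtain ⟨c, hc, hq⟩ := qs_clear (S := S) p.primeCompl
    (Sum.elim (fun z : Fin n × Fin n => H z.1 z.2) (fun z : Fin n × Fin n => H' z.1 z.2))
    (by
      rintro (⟨x, y⟩ | ⟨x, y⟩)
      · exact hone H hH0 x y
      · exact hone H' hH0' x y)
  choose q hq using hq
  let K : Matrix (Fin n) (Fin n) R[X][X] := fun x y => q (Sum.inl (x, y))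
  let K' : Matrix (Fin n) (Fin n) R[X][X] := fun x y => q (Sum.inr (x, y))
  let τ := compRingHom (C (C (algebraMap R S c)) * X : S[X][X])
  have hK : K.map j = H.map τ := by ext1 x y; exact hq _
  have hK' : K'.map j = H'.map τ := by ext1 x y; exact hq _
  have hjinj : Function.Injective (fun N : Matrix (Fin n) (Fin n) R[X][X] => N.map j) :=
    Matrix.map_injective hinj
  let θ' : R[X] →+* R[X][X] := eval₂RingHom ((C : R[X] →+* R[X][X]).comp (C : R →+* R[X]))
    (C X + C (C c) * X : R[X][X])
  have hconj : QSConj (E.map θ') (E.map (C : R[X] →+* R[X][X])) := by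
    refine ⟨K, K', hjinj ?_, hjinj ?_, hjinj ?_⟩
    · simp only [Matrix.map_mul, hK, hK']
      rw [← Matrix.map_mul, hH1]; simp
    · simp only [Matrix.map_mul, hK, hK']
      rw [← Matrix.map_mul, hH2]; simp
    · simp only [Matrix.map_mul, hK]
      have b1 : (E.map θ').map j = ((E.map i1).map θ).map τ := by
        simp only [qs_map_comp]
        congr 2
        ext <;> simp [θ', θ, τ, i1, j]
      have b2 : (E.map (C : R[X] →+* R[X][X])).map j = ((E.map i1).map C).map τ := by
        simp only [qs_map_comp]
        congr 2
        ext <;> simp [τ, i1, j]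
      rw [b1, b2, ← Matrix.map_mul, hH3, Matrix.map_mul]
  refine ⟨c, hc, fun B _ φ a b => ?_⟩
  have := hconj.map (eval₂RingHom (eval₂RingHom φ a) b)
  simp only [qs_map_comp] at this
  convert this using 3
  · ext <;> simp [θ']
  · ext <;> simp

lemma qs_patch {R : Type} [CommRing R] [IsDomain R] {n : ℕ}
    (E : Matrix (Fin n) (Fin n) R[X])
    (h : ∀ (p : Ideal R) [p.IsMaximal], ∃ d,
      QSConj (E.map (mapRingHom (algebraMap R (Localization.AtPrime p)))) (qsD _ d)) :
    QSConj E ((E.map (evalRingHom 0)).map C) := by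
  let I : Ideal R :=
    { carrier := {c | ∀ (B : Type) [CommRing B] (φ : R →+* B) (a b : B),
        QSConj (E.map (eval₂RingHom φ (a + φ c * b))) (E.map (eval₂RingHom φ a))}
      zero_mem' := by
        intro B _ φ a b
        simp only [map_zero, zero_mul, add_zero]
        exact ⟨1, 1, by simp, by simp, by simp⟩
      add_mem' := by
        intro c c' hc hc' B _ φ a b
        have h1 := hc B φ (a + φ c' * b) b
        have h2 := hc' B φ a b
        have : a + φ (c + c') * b = a + φ c' * b + φ c * b := by rw [map_add]; ring
        rw [this]
        exact h1.trans h2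
      smul_mem' := by
        intro r c hc B _ φ a b
        have := hc B φ a (φ r * b)
        have e : a + φ (r • c) * b = a + φ c * (φ r * b) := by
          rw [smul_eq_mul, map_mul]; ring
        rw [e]
        exact this }
  have hI : I = ⊤ := by
    by_contra hI
    obtain ⟨p, hp, hIp⟩ := Ideal.exists_le_maximal I hI
    obtain ⟨d, hd⟩ := h p
    obtain ⟨c, hc, hcI⟩ := qs_patch_local E p d _ hd
    exact hc (hIp hcI)
  have h1 : (1 : R) ∈ I := by rw [hI]; trivial
  have := h1 R[X] C 0 X
  rw [qs_map_comp]
  convert this using 1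
  · have : eval₂RingHom C (0 + C (1 : R) * X) = RingHom.id R[X] := by ext <;> simp
    rw [this]
    ext; simp
  · congr 2
    ext <;> simp


lemma qs_denoms (k : Type) [Field k] (n : ℕ) :
    ∃ j : (MvPolynomial (Fin n) k)[X] →+* MvPolynomial (Fin n) (FractionRing k[X]),
      Function.Injective j ∧
      (∀ s : k[X], j (s.map MvPolynomial.C) = MvPolynomial.C (algebraMap k[X] (FractionRing k[X]) s)) ∧
      ∀ (ι : Type) [Fintype ι] (x : ι → MvPolynomial (Fin n) (FractionRing k[X])),
        ∃ s : k[X], s ≠ 0 ∧ ∀ i, ∃ y, j y =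
          MvPolynomial.C (algebraMap k[X] (FractionRing k[X]) s) * x i := by
  let Ψ : (MvPolynomial (Fin n) k)[X] ≃ₐ[k] MvPolynomial (Fin n) k[X] :=
    (MvPolynomial.optionEquivLeft k (Fin n)).symm.trans (MvPolynomial.optionEquivRight k (Fin n))
  let m : MvPolynomial (Fin n) k[X] →+* MvPolynomial (Fin n) (FractionRing k[X]) :=
    MvPolynomial.map (algebraMap k[X] (FractionRing k[X]))
  have hX : Ψ X = MvPolynomial.C X := by
    have : (MvPolynomial.optionEquivLeft k (Fin n)).symm X = MvPolynomial.X none := by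
      rw [AlgEquiv.symm_apply_eq, MvPolynomial.optionEquivLeft_X_none]
    simp [Ψ, this, MvPolynomial.optionEquivRight_X_none]
  have hC : ∀ s : k[X], Ψ (s.map MvPolynomial.C) = MvPolynomial.C s := by
    intro s
    have : ((Ψ : _ →+* MvPolynomial (Fin n) k[X]).comp (mapRingHom (MvPolynomial.C (σ := Fin n)))) = MvPolynomial.C := by
      apply Polynomial.ringHom_ext
      · intro a
        have h1 : (C (MvPolynomial.C a) : (MvPolynomial (Fin n) k)[X]) = algebraMap k _ a := rfl
        have h2 : (MvPolynomial.C (C a) : MvPolynomial (Fin n) k[X]) = algebraMap k _ a := rfl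
        simp only [RingHom.comp_apply, coe_mapRingHom, Polynomial.map_C]
        rw [h1, h2]
        exact Ψ.commutes a
      · simpa using hX
    exact RingHom.congr_fun this s
  refine ⟨m.comp (Ψ : _ →+* MvPolynomial (Fin n) k[X]), ?_, ?_, ?_⟩
  · exact (MvPolynomial.map_injective _ (IsFractionRing.injective k[X] (FractionRing k[X]))).comp Ψ.injective
  · intro s
    have := hC s
    simp only [RingHom.comp_apply, RingHom.coe_coe, this, m, MvPolynomial.map_C]
  · intro ι _ x
    letI := MvPolynomial.algebraMvPolynomial (σ := Fin n) (R := k[X]) (S := FractionRing k[X])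
    have := MvPolynomial.isLocalization (nonZeroDivisors k[X]) (FractionRing k[X]) (σ := Fin n)
    obtain ⟨⟨b, s, hs, rfl⟩, hb⟩ := IsLocalization.exist_integer_multiples
      (Submonoid.map (MvPolynomial.C (σ := Fin n)) (nonZeroDivisors k[X])) Finset.univ x
    refine ⟨s, nonZeroDivisors.ne_zero hs, fun i => ?_⟩
    obtain ⟨y, hy⟩ := hb i (Finset.mem_univ _)
    refine ⟨Ψ.symm y, ?_⟩
    have h3 : m y = _ := hy
    have h4 : (m.comp (Ψ : _ →+* MvPolynomial (Fin n) k[X])) (Ψ.symm y) = m y := by simp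
    rw [h4, h3, Algebra.smul_def]
    congr 1
    exact MvPolynomial.map_C _ _

lemma qs_generic (k : Type) [Field k] (n : ℕ)
    (H : QSMat (MvPolynomial (Fin n) (FractionRing k[X]))) {m : ℕ}
    (E : Matrix (Fin m) (Fin m) (MvPolynomial (Fin n) k)[X]) (hE : E * E = E) :
    ∃ (d : Fin m → Bool) (G G' : Matrix (Fin m) (Fin m) (MvPolynomial (Fin n) k)[X])
      (f : (MvPolynomial (Fin n) k)[X]), f.Monic ∧ G * G' = f • (1 : Matrix _ _ _) ∧
      G' * G = f • (1 : Matrix _ _ _) ∧ E * G = G * qsD _ d := by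
  obtain ⟨j, hj, hjC, hden⟩ := qs_denoms k n
  obtain ⟨d, U, V, h1, h2, h3⟩ := H m (E.map j) (by rw [← Matrix.map_mul, hE])
  obtain ⟨s, hs, hU⟩ := hden (Fin m × Fin m) (fun z => U z.1 z.2)
  obtain ⟨t, ht, hV⟩ := hden (Fin m × Fin m) (fun z => V z.1 z.2)
  choose u hu using hU
  choose v hv using hV
  let a : k := (s * t).leadingCoeff⁻¹
  have hst : s * t ≠ 0 := mul_ne_zero hs ht
  let α : k[X] → MvPolynomial (Fin n) (FractionRing k[X]) := fun s =>
    MvPolynomial.C (algebraMap k[X] (FractionRing k[X]) s)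
  let G : Matrix (Fin m) (Fin m) (MvPolynomial (Fin n) k)[X] := fun x y =>
    (C a : k[X]).map MvPolynomial.C * u (x, y)
  let G' : Matrix (Fin m) (Fin m) (MvPolynomial (Fin n) k)[X] := fun x y => v (x, y)
  have hinj : Function.Injective (fun N : Matrix (Fin m) (Fin m) (MvPolynomial (Fin n) k)[X] => N.map j) :=
    Matrix.map_injective hj
  have hG : G.map j = α (C a * s) • U := by
    ext1 x y
    rw [Matrix.map_apply, Matrix.smul_apply, smul_eq_mul]
    simp only [G, map_mul, hjC, hu, α]
    rw [mul_assoc]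
  have hG' : G'.map j = α t • V := by
    ext1 x y
    exact hv _
  have hα : α (C a * s) * α t = α (C a * (s * t)) := by simp only [α, ← map_mul, mul_assoc]
  have hf : ((C a * (s * t)).map (MvPolynomial.C (σ := Fin n)) • (1 : Matrix (Fin m) (Fin m) (MvPolynomial (Fin n) k)[X])).map j
      = α (C a * (s * t)) • 1 := by
    ext1 x y
    rw [Matrix.map_apply, Matrix.smul_apply, Matrix.smul_apply, smul_eq_mul, smul_eq_mul, map_mul, hjC]
    congr 1
    simp only [Matrix.one_apply]
    split_ifs <;> simp
  refine ⟨d, G, G', (C a * (s * t)).map MvPolynomial.C, ?_, hinj ?_, hinj ?_, hinj ?_⟩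
  · apply Polynomial.Monic.map
    rw [mul_comm]
    exact monic_mul_leadingCoeff_inv hst
  · simp only [Matrix.map_mul, hG, hG', hf]
    rw [Matrix.smul_mul, Matrix.mul_smul, smul_smul, h1, hα]
  · simp only [Matrix.map_mul, hG, hG', hf]
    rw [Matrix.smul_mul, Matrix.mul_smul, smul_smul, h2, mul_comm, hα]
  · simp only [Matrix.map_mul, hG, qsD_map]
    rw [Matrix.mul_smul, h3, Matrix.smul_mul]

lemma QSMat.ringEquiv {R S : Type} [CommRing R] [CommRing S] (e : R ≃+* S) (h : QSMat S) :
    QSMat R := by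
  intro n E hE
  obtain ⟨d, hd⟩ := h n (E.map (e : R →+* S)) (by rw [← Matrix.map_mul, hE])
  refine ⟨d, ?_⟩
  have := hd.map (e.symm : S →+* R)
  rw [qsD_map, qs_map_comp] at this
  convert this using 1
  ext; simp

lemma qs_step {R : Type} [CommRing R] [IsDomain R] [UniqueFactorizationMonoid R]
    (hR : QSMat R)
    (H : ∀ (m : ℕ) (E : Matrix (Fin m) (Fin m) R[X]), E * E = E →
      ∃ (d : Fin m → Bool) (G G' : Matrix (Fin m) (Fin m) R[X])
      (f : R[X]), f.Monic ∧ G * G' = f • (1 : Matrix _ _ _) ∧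
      G' * G = f • (1 : Matrix _ _ _) ∧ E * G = G * qsD _ d) : QSMat R[X] := by
  intro m E hE
  obtain ⟨d, G, G', f, hf, h1, h2, h3⟩ := H m E hE
  have hp : QSConj E ((E.map (evalRingHom 0)).map C) := by
    refine qs_patch E fun p hp => ?_
    haveI : IsDomain (Localization.AtPrime p) :=
      IsLocalization.isDomain_localization p.primeCompl_le_nonZeroDivisors
    haveI : UniqueFactorizationMonoid (Localization.AtPrime p) :=
      inferInstance
    let i := mapRingHom (algebraMap R (Localization.AtPrime p))
    have hs : (f • (1 : Matrix (Fin m) (Fin m) R[X])).map i = (i f) • 1 := by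
      ext1 x y
      rw [Matrix.map_apply, Matrix.smul_apply, Matrix.smul_apply, smul_eq_mul, smul_eq_mul, map_mul]
      congr 1
      simp only [Matrix.one_apply]
      split_ifs <;> simp
    refine qs_local (E.map i) (by rw [← Matrix.map_mul, hE]) d (G.map i) (G'.map i) (i f)
      (hf.map _) ?_ ?_ ?_
    · rw [← Matrix.map_mul, h1, hs]
    · rw [← Matrix.map_mul, h2, hs]
    · rw [← Matrix.map_mul, h3, Matrix.map_mul, qsD_map]
  obtain ⟨d, hd⟩ := hR m (E.map (evalRingHom 0)) (by rw [← Matrix.map_mul, hE])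
  refine ⟨d, hp.trans ?_⟩
  have := hd.map (C : R →+* R[X])
  rwa [qsD_map] at this

lemma qs_main (n : ℕ) : ∀ (k : Type) [Field k], QSMat (MvPolynomial (Fin n) k) := by
  induction n with
  | zero =>
    intro k _
    refine QSMat.ringEquiv (MvPolynomial.isEmptyRingEquiv k (Fin 0)) (QSFree.mat ?_)
    intro P _ _ _ _
    infer_instance
  | succ n ih =>
    intro k _
    refine QSMat.ringEquiv (MvPolynomial.finSuccEquiv k n).toRingEquiv ?_
    exact qs_step (ih k) fun m E hE => qs_generic k n (ih _) E hE


end QuillenSuslin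

/-- If `P(σ)` is a direct summand of `A` (a projective module), `Δ(π)` is an `A`-module
which is finitely generated and free over `B(π) = End_A(Δ(π))^op`, and `B(π)` is a
polynomial algebra, then `Hom_A(P(σ), Δ(π))` is a finitely generated free
`B(π)`-module. -/
theorem stmt_9
    {k A : Type} [Field k] [Ring A] [Algebra k A]
    {Δ : Type} [AddCommGroup Δ] [Module A Δ]
    {P : Type} [AddCommGroup P] [Module A P]
    -- `P` is a direct summand of `A` as a left `A`-module
    (ι : P →ₗ[A] A) (pr : A →ₗ[A] P) (hsplit : pr.comp ι = LinearMap.id)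
    -- `B(π) = End_A(Δ)^op` is a (commutative) polynomial algebra
    (r : ℕ) (hpoly : Nonempty (Module.End A Δ ≃+* MvPolynomial (Fin r) k))
    -- `Δ` is finitely generated and free over `B(π)` (acting by evaluation)
    (hfin : Module.Finite (Module.End A Δ) Δ)
    (hfree : Module.Free (Module.End A Δ) Δ) :
    Module.Finite (Module.End A Δ) (P →ₗ[A] Δ) ∧
      Module.Free (Module.End A Δ) (P →ₗ[A] Δ) := by
  obtain ⟨e⟩ := hpoly
  let i : (P →ₗ[A] Δ) →ₗ[Module.End A Δ] Δ :=
    { toFun := fun φ => φ (pr 1)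
      map_add' := fun _ _ => rfl
      map_smul' := fun _ _ => rfl }
  let s : Δ →ₗ[Module.End A Δ] (P →ₗ[A] Δ) :=
    { toFun := fun x => (LinearMap.toSpanSingleton A Δ x).comp ι
      map_add' := fun x y => by ext; simp
      map_smul' := fun b x => by ext p; simp }
  have hsi : s.comp i = LinearMap.id := by
    ext φ p
    have : pr (ι p) = p := LinearMap.congr_fun hsplit p
    simp only [s, i, LinearMap.comp_apply, LinearMap.coe_mk, AddHom.coe_mk,
      LinearMap.toSpanSingleton_apply, LinearMap.id_apply]
    rw [← map_smul, ← map_smul, smul_eq_mul, mul_one, this]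
  have hF : Module.Finite (Module.End A Δ) (P →ₗ[A] Δ) :=
    Module.Finite.of_surjective s fun φ => ⟨i φ, LinearMap.congr_fun hsi φ⟩
  have hP : Module.Projective (Module.End A Δ) (P →ₗ[A] Δ) := Module.Projective.of_split i s hsi
  refine ⟨hF, ?_⟩
  letI : Module (MvPolynomial (Fin r) k) (P →ₗ[A] Δ) := Module.compHom _ (e.symm : _ →+* Module.End A Δ)
  haveI := RingHomInvPair.of_ringEquiv e
  haveI := RingHomInvPair.of_ringEquiv e.symm
  let ε : (P →ₗ[A] Δ) ≃ₛₗ[(e : Module.End A Δ →+* MvPolynomial (Fin r) k)] (P →ₗ[A] Δ) :=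
    { AddEquiv.refl _ with
      map_smul' := fun b x => by
        change b • x = (e.symm (e b)) • x
        rw [e.symm_apply_apply] }
  haveI : Module.Finite (MvPolynomial (Fin r) k) (P →ₗ[A] Δ) :=
    Module.Finite.of_surjective ε.toLinearMap ε.surjective
  haveI : Module.Projective (MvPolynomial (Fin r) k) (P →ₗ[A] Δ) := Module.Projective.of_equiv ε
  haveI : Module.Free (MvPolynomial (Fin r) k) (P →ₗ[A] Δ) := (qs_main r k).free (P →ₗ[A] Δ)
  exact Module.Free.of_equiv ε.symm
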